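/- Every time-convergent infinite play of the expanded timed game G(p,λ) either visits bad locations only finitely often or visits non-bad locations only finitely often; that is, it belongs to coBüchi(L'∖Bad) ∪ coBüchi(Bad), and no infinite play belongs to both of these sets. -/

import Mathlib

open scoped NNReal

namespace TWPaper

variable {L C Act : Type}

/-- Comparison operators appearing in clock constraints. -/
inductive Cmp where
  | le | ge | lt | gt

/-- An atomic clock constraint `x ∼ c` with `c : ℕ`. -/
structure Atom (C : Type) where
  clock : C
  cmp : Cmp
  bound : ℕ

/-- Clock valuations. -/
abbrev Val (C : Type) := C → ℝ≥0

def Atom.sat (ν : Val C) (a : Atom C) : Prop :=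
  match a.cmp with
  | Cmp.le => ν a.clock ≤ (a.bound : ℝ≥0)
  | Cmp.ge => (a.bound : ℝ≥0) ≤ ν a.clock
  | Cmp.lt => ν a.clock < (a.bound : ℝ≥0)
  | Cmp.gt => (a.bound : ℝ≥0) < ν a.clock

/-- A clock constraint: a finite conjunction of atomic constraints. -/
abbrev ClockConstraint (C : Type) := List (Atom C)

def satCC (ν : Val C) (g : ClockConstraint C) : Prop := ∀ a ∈ g, a.sat ν

/-- Let `d` time units pass. -/
def shift (ν : Val C) (d : ℝ≥0) : Val C := fun x => ν x + d

open Classical in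
/-- Reset the clocks in `D` to `0`. -/
noncomputable def resetV (D : Set C) (ν : Val C) : Val C :=
  fun x => if x ∈ D then 0 else ν x

structure Edge (L C Act : Type) where
  src : L
  guard : ClockConstraint C
  act : Act
  resets : Set C
  tgt : L

/-- A timed automaton. -/
structure TA (L C Act : Type) where
  init : L
  gamma : C
  inv : L → ClockConstraint C
  edges : Set (Edge L C Act)

/-- Well-formedness of a timed automaton: the special global clock `γ` is never
reset, and no two edges from the same location sharing an action have
simultaneously satisfiable guards (determinism). -/
def TA.WellFormed (A : TA L C Act) : Prop :=
  (∀ e ∈ A.edges, A.gamma ∉ e.resets) ∧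
  (∀ e₁ ∈ A.edges, ∀ e₂ ∈ A.edges, e₁.src = e₂.src → e₁.act = e₂.act →
    (∃ ν : Val C, satCC ν e₁.guard ∧ satCC ν e₂.guard) → e₁ = e₂)

/-- A move: a delay together with an action (`none` is the special delay action `⊥`). -/
abbrev Mv (Act : Type) := ℝ≥0 × Option Act

/-- The transition relation of the transition system of a timed automaton. -/
def TA.Trans (A : TA L C Act) (s : L × Val C) (m : Mv Act) (s' : L × Val C) : Prop :=
  satCC (shift s.2 m.1) (A.inv s.1) ∧
  (match m.2 with
   | none => s'.1 = s.1 ∧ s'.2 = shift s.2 m.1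
   | some a => ∃ e ∈ A.edges, e.src = s.1 ∧ e.act = a ∧
       satCC (shift s.2 m.1) e.guard ∧ s'.1 = e.tgt ∧
       s'.2 = resetV e.resets (shift s.2 m.1) ∧ satCC s'.2 (A.inv e.tgt))

/-- An infinite path of a timed automaton (the underlying data). -/
structure RawPath (L C Act : Type) where
  s : ℕ → L × Val C
  m : ℕ → Mv Act

def TA.IsPath (A : TA L C Act) (π : RawPath L C Act) : Prop :=
  ∀ n, A.Trans (π.s n) (π.m n) (π.s (n + 1))

/-- A timed game: a timed automaton together with a partition of the actions;
`isP1 a` means that `a` is a player-1 action (its complement is player 2's set). -/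
structure TG (L C Act : Type) where
  ta : TA L C Act
  isP1 : Act → Prop

/-- Moves available to player 1 in state `s`. -/
def TG.Move1 (G : TG L C Act) (s : L × Val C) (m : Mv Act) : Prop :=
  (∀ a, m.2 = some a → G.isP1 a) ∧ ∃ s', G.ta.Trans s m s'

/-- Moves available to player 2 in state `s`. -/
def TG.Move2 (G : TG L C Act) (s : L × Val C) (m : Mv Act) : Prop :=
  (∀ a, m.2 = some a → ¬ G.isP1 a) ∧ ∃ s', G.ta.Trans s m s'

/-- An infinite play of a timed game (the underlying data). -/
structure RawPlay (L C Act : Type) where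
  s : ℕ → L × Val C
  m1 : ℕ → Mv Act
  m2 : ℕ → Mv Act

/-- The delay at step `n`: the minimum of the delays of the two chosen moves. -/
def RawPlay.delay (π : RawPlay L C Act) (n : ℕ) : ℝ≥0 := min (π.m1 n).1 (π.m2 n).1

/-- The play obtained by removing the first `n` steps. -/
def RawPlay.drop (π : RawPlay L C Act) (n : ℕ) : RawPlay L C Act :=
  ⟨fun k => π.s (n + k), fun k => π.m1 (n + k), fun k => π.m2 (n + k)⟩

/-- The joint destination relation: the fastest move is carried out,
nondeterministically so in case of a tie. -/
def TG.JointDest (G : TG L C Act) (s : L × Val C) (m₁ m₂ : Mv Act) (s' : L × Val C) : Prop :=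
  (m₁.1 < m₂.1 ∧ G.ta.Trans s m₁ s') ∨ (m₂.1 < m₁.1 ∧ G.ta.Trans s m₂ s') ∨
  (m₁.1 = m₂.1 ∧ (G.ta.Trans s m₁ s' ∨ G.ta.Trans s m₂ s'))

def TG.StepOK (G : TG L C Act) (π : RawPlay L C Act) (n : ℕ) : Prop :=
  G.Move1 (π.s n) (π.m1 n) ∧ G.Move2 (π.s n) (π.m2 n) ∧
  G.JointDest (π.s n) (π.m1 n) (π.m2 n) (π.s (n + 1))

def TG.IsPlay (G : TG L C Act) (π : RawPlay L C Act) : Prop := ∀ n, G.StepOK π n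

/-- `π` is a valid play for its first `n` steps (i.e., viewed as a finite play
consisting of `n` moves). -/
def TG.IsPlayUpTo (G : TG L C Act) (π : RawPlay L C Act) (n : ℕ) : Prop :=
  ∀ k < n, G.StepOK π k

/-- The state/delay sequence of a play or path.  All the objectives considered
are state-based and are therefore defined on traces. -/
structure Trace (L C : Type) where
  st : ℕ → L × Val C
  dl : ℕ → ℝ≥0

def RawPlay.trace (π : RawPlay L C Act) : Trace L C := ⟨π.s, fun n => π.delay n⟩
def RawPath.trace (π : RawPath L C Act) : Trace L C := ⟨π.s, fun n => (π.m n).1⟩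

/-- The delayed suffix `π_{n→}^{+d}`. -/
noncomputable def Trace.delayedSuffix (τ : Trace L C) (n : ℕ) (d : ℝ≥0) : Trace L C where
  st := fun k => if k = 0 then ((τ.st n).1, shift (τ.st n).2 d) else τ.st (n + k)
  dl := fun k => if k = 0 then τ.dl n - d else τ.dl (n + k)

/-- The suffix `π_{n→} = π_{n→}^{+0}`. -/
noncomputable def Trace.suffix (τ : Trace L C) (n : ℕ) : Trace L C := τ.delayedSuffix n 0

/-- `min_{a ≤ k ≤ b} p(ℓ_k)`. -/
noncomputable def minPrioIcc (p : L → ℕ) (τ : Trace L C) (a b : ℕ) : ℕ :=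
  sInf ((fun k => p (τ.st k).1) '' Set.Icc a b)

/-- The timed good window objective `TGW(p, λ)`. -/
def TGW (γ : C) (p : L → ℕ) (lam : ℕ) : Set (Trace L C) :=
  {τ | ∃ j : ℕ, Even (minPrioIcc p τ 0 j) ∧ (τ.st j).2 γ - (τ.st 0).2 γ < (lam : ℝ≥0)}

/-- The direct timed window parity objective `DTW(p, λ)`. -/
def DTW (γ : C) (p : L → ℕ) (lam : ℕ) : Set (Trace L C) :=
  {τ | ∀ n : ℕ, ∀ d : ℝ≥0, d ≤ τ.dl n → τ.delayedSuffix n d ∈ TGW γ p lam}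

/-- The timed window parity objective `TW(p, λ)`. -/
def TW (γ : C) (p : L → ℕ) (lam : ℕ) : Set (Trace L C) :=
  {τ | ∃ n : ℕ, τ.suffix n ∈ DTW γ p lam}

/-- Time divergence: the global clock `γ` is unbounded along the trace. -/
def TimeDiv (γ : C) (τ : Trace L C) : Prop := ∀ B : ℝ≥0, ∃ j, B < (τ.st j).2 γ

/-- The parity objective: the least priority seen infinitely often is even. -/
def ParityObj (p : L → ℕ) : Set (Trace L C) :=
  {τ | Even (Filter.liminf (fun n => p (τ.st n).1) Filter.atTop)}

/-- The safety objective for the set `F` of locations. -/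
def SafeObj (F : Set L) : Set (Trace L C) := {τ | ∀ n, (τ.st n).1 ∉ F}

/-- The co-Büchi objective for the set `F` of locations. -/
def CoBuchiObj (F : Set L) : Set (Trace L C) := {τ | ∃ N, ∀ n ≥ N, (τ.st n).1 ∉ F}

/-! ### The expanded timed automaton (one dimension) -/

/-- Locations of the expanded automaton: `(ℓ, some q)` carries the priority `q`
of the current window, `(ℓ, none)` is the bad location `(ℓ, bad)`. -/
abbrev ExpLoc (L : Type) := L × Option ℕ
/-- Clocks of the expanded automaton: `none` is the fresh clock `z`. -/
abbrev ExpClock (C : Type) := Option C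
/-- Actions of the expanded automaton: `Sum.inr true = β₁` and `Sum.inr false = β₂`. -/
abbrev ExpAct (Act : Type) := Act ⊕ Bool

def liftAtom {C C' : Type} (f : C → C') (a : Atom C) : Atom C' := ⟨f a.clock, a.cmp, a.bound⟩

def liftCC {C C' : Type} (f : C → C') (g : ClockConstraint C) : ClockConstraint C' :=
  g.map (liftAtom f)

/-- The expanded timed automaton `A(p, λ)`, where the priorities used range over
`{0, …, d-1}`. -/
def expTA (A : TA L C Act) (d : ℕ) (p : L → ℕ) (lam : ℕ) :
    TA (ExpLoc L) (ExpClock C) (ExpAct Act) where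
  init := (A.init, some (p A.init))
  gamma := some A.gamma
  inv := fun lq =>
    match lq.2 with
    | some q => liftCC some (A.inv lq.1) ++
        (if q % 2 = 1 then [⟨none, Cmp.le, lam⟩] else [])
    | none => [⟨none, Cmp.le, 0⟩, ⟨none, Cmp.ge, 0⟩]
  edges :=
    {e : Edge (ExpLoc L) (ExpClock C) (ExpAct Act) |
      ∃ q < d, q % 2 = 0 ∧ ∃ e₀ ∈ A.edges,
        e = ⟨(e₀.src, some q), liftCC some e₀.guard, Sum.inl e₀.act,
             (Option.some '' e₀.resets) ∪ {none}, (e₀.tgt, some (p e₀.tgt))⟩} ∪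
    {e : Edge (ExpLoc L) (ExpClock C) (ExpAct Act) |
      ∃ q < d, q % 2 = 1 ∧ ∃ e₀ ∈ A.edges,
        e = ⟨(e₀.src, some q), liftCC some e₀.guard ++ [⟨none, Cmp.lt, lam⟩],
             Sum.inl e₀.act, Option.some '' e₀.resets,
             (e₀.tgt, some (min q (p e₀.tgt)))⟩} ∪
    {e : Edge (ExpLoc L) (ExpClock C) (ExpAct Act) |
      ∃ q < d, q % 2 = 1 ∧ ∃ (ℓ : L) (b : Bool),
        e = ⟨(ℓ, some q), [⟨none, Cmp.le, lam⟩, ⟨none, Cmp.ge, lam⟩], Sum.inr b,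
             {none}, (ℓ, none)⟩} ∪
    {e : Edge (ExpLoc L) (ExpClock C) (ExpAct Act) |
      ∃ (ℓ : L) (b : Bool), e = ⟨(ℓ, none), [], Sum.inr b, ∅, (ℓ, some (p ℓ))⟩}

/-- The expanded timed game `G(p, λ)`: `β₁` belongs to player 1, `β₂` to player 2. -/
def expTG (G : TG L C Act) (d : ℕ) (p : L → ℕ) (lam : ℕ) :
    TG (ExpLoc L) (ExpClock C) (ExpAct Act) :=
  ⟨expTA G.ta d p lam,
   fun a => match a with | Sum.inl a => G.isP1 a | Sum.inr b => b = true⟩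

/-- The set `Bad = L × {bad}` of bad locations. -/
def BadLocs (L : Type) : Set (ExpLoc L) := {lq | lq.2 = none}

/-! ### The projection mapping -/

def projMove (m : Mv (ExpAct Act)) : Mv Act :=
  (m.1, match m.2 with
        | some (Sum.inl a) => some a
        | some (Sum.inr _) => none
        | none => none)

def projState (s : ExpLoc L × Val (ExpClock C)) : L × Val C :=
  (s.1.1, fun c => s.2 (some c))

/-- The projection mapping `Pr`. -/
def projPlay (π : RawPlay (ExpLoc L) (ExpClock C) (ExpAct Act)) : RawPlay L C Act :=
  ⟨fun n => projState (π.s n), fun n => projMove (π.m1 n), fun n => projMove (π.m2 n)⟩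

/-- A play of the expanded game is well-initialized if `q₀ = p(ℓ₀)` and `ν₀(z) = 0`. -/
def WellInit (p : L → ℕ) (π : RawPlay (ExpLoc L) (ExpClock C) (ExpAct Act)) : Prop :=
  (π.s 0).1.2 = some (p (π.s 0).1.1) ∧ (π.s 0).2 none = 0

/-! ### The expansion mapping -/

def liftMove (m : Mv Act) : Mv (ExpAct Act) := (m.1, m.2.map Sum.inl)

def betaMv {Act : Type} (b : Bool) (t : ℝ≥0) : Mv (ExpAct Act) := (t, some (Sum.inr b))

/-- The conditions relating step `n` of a play `π` of `G` to the segment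
`[f n, f (n+1)]` of its expansion `π'`, following the inductive definition of
the expansion mapping `Ex`. -/
def ExStep (p : L → ℕ) (lam : ℕ) (π : RawPlay L C Act)
    (π' : RawPlay (ExpLoc L) (ExpClock C) (ExpAct Act)) (f : ℕ → ℕ) (n : ℕ) : Prop :=
  ∃ q : ℕ, (π'.s (f n)).1.2 = some q ∧
    (∀ z dn : ℝ≥0, z = (π'.s (f n)).2 none → dn = π.delay n →
      -- Cases 1 and 2.a : no bad window is detected during this step
      ((q % 2 = 0 ∨ z + dn < (lam : ℝ≥0)) →
        f (n + 1) = f n + 1 ∧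
        (q % 2 = 0 →
          π'.m1 (f n) = liftMove (π.m1 n) ∧ π'.m2 (f n) = liftMove (π.m2 n)) ∧
        (q % 2 = 1 →
          ((z + (π.m1 n).1 < (lam : ℝ≥0) → π'.m1 (f n) = liftMove (π.m1 n)) ∧
           ((lam : ℝ≥0) ≤ z + (π.m1 n).1 →
              π'.m1 (f n) = betaMv true ((lam : ℝ≥0) - z)) ∧
           (z + (π.m2 n).1 < (lam : ℝ≥0) → π'.m2 (f n) = liftMove (π.m2 n)) ∧
           ((lam : ℝ≥0) ≤ z + (π.m2 n).1 →
              π'.m2 (f n) = betaMv false ((lam : ℝ≥0) - z))))) ∧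
      -- Case 2.b : a bad window is detected during this step; the expansion
      -- visits the bad location `μ` times
      (q % 2 = 1 → (lam : ℝ≥0) ≤ z + dn →
        ∃ μ : ℕ, 1 ≤ μ ∧
          (p (π.s n).1 % 2 = 0 → μ = 1) ∧
          (p (π.s n).1 % 2 = 1 →
            ((μ * lam : ℕ) : ℝ≥0) ≤ z + dn ∧ z + dn < (((μ + 1) * lam : ℕ) : ℝ≥0)) ∧
          f (n + 1) = f n + 2 * μ + 1 ∧
          (∀ k < μ, (π'.s (f n + 2 * k + 1)).1 = ((π.s n).1, none)) ∧
          (∀ k, 1 ≤ k → k ≤ μ →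
            (π'.s (f n + 2 * k)).1 = ((π.s n).1, some (p (π.s n).1))) ∧
          π'.m1 (f n) = betaMv true ((lam : ℝ≥0) - z) ∧
          π'.m2 (f n) = betaMv false ((lam : ℝ≥0) - z) ∧
          (∀ k < μ, π'.m1 (f n + 2 * k + 1) = betaMv true 0 ∧
                    π'.m2 (f n + 2 * k + 1) = betaMv false 0) ∧
          (∀ k, 1 ≤ k → k < μ →
            π'.m1 (f n + 2 * k) = betaMv true (lam : ℝ≥0) ∧
            π'.m2 (f n + 2 * k) = betaMv false (lam : ℝ≥0)) ∧
          (∀ t' : ℝ≥0, t' = ((lam : ℝ≥0) - z) + ((μ - 1 : ℕ) : ℝ≥0) * (lam : ℝ≥0) →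
            (((π.m1 n).1 - t' < (lam : ℝ≥0) ∨ p (π.s n).1 % 2 = 0) →
              π'.m1 (f n + 2 * μ) = ((π.m1 n).1 - t', (π.m1 n).2.map Sum.inl)) ∧
            (¬ ((π.m1 n).1 - t' < (lam : ℝ≥0) ∨ p (π.s n).1 % 2 = 0) →
              π'.m1 (f n + 2 * μ) = betaMv true (lam : ℝ≥0)) ∧
            (((π.m2 n).1 - t' < (lam : ℝ≥0) ∨ p (π.s n).1 % 2 = 0) →
              π'.m2 (f n + 2 * μ) = ((π.m2 n).1 - t', (π.m2 n).2.map Sum.inl)) ∧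
            (¬ ((π.m2 n).1 - t' < (lam : ℝ≥0) ∨ p (π.s n).1 % 2 = 0) →
              π'.m2 (f n + 2 * μ) = betaMv false (lam : ℝ≥0)))))

/-- `π'` is the expansion `Ex(π)` of the play `π`, presented relationally:
`π'` is a play of the expanded game `G(p, λ)`, and there is an alignment
function `f` matching each step of `π` with the corresponding segment of `π'`
according to the inductive definition of the expansion mapping. -/
def IsExpansion (G : TG L C Act) (d : ℕ) (p : L → ℕ) (lam : ℕ)
    (π : RawPlay L C Act) (π' : RawPlay (ExpLoc L) (ExpClock C) (ExpAct Act)) : Prop :=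
  (expTG G d p lam).IsPlay π' ∧
  ∃ f : ℕ → ℕ, f 0 = 0 ∧ StrictMono f ∧
    (π'.s 0).1.2 = some (p (π.s 0).1) ∧ (π'.s 0).2 none = 0 ∧
    (∀ n, (π'.s (f n)).1.1 = (π.s n).1 ∧ (π'.s (f n)).1.2 ≠ none ∧
          (∀ c : C, (π'.s (f n)).2 (some c) = (π.s n).2 c)) ∧
    (∀ n, ExStep p lam π π' f n)

/-- The finite-play version of `IsExpansion`: the first `N` steps of `π'` form
the expansion of the finite play consisting of the first `n` steps of `π`. -/
def IsExpansionUpTo (G : TG L C Act) (d : ℕ) (p : L → ℕ) (lam : ℕ)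
    (π : RawPlay L C Act) (π' : RawPlay (ExpLoc L) (ExpClock C) (ExpAct Act))
    (n N : ℕ) : Prop :=
  (expTG G d p lam).IsPlayUpTo π' N ∧
  ∃ f : ℕ → ℕ, f 0 = 0 ∧ StrictMono f ∧ f n = N ∧
    (π'.s 0).1.2 = some (p (π.s 0).1) ∧ (π'.s 0).2 none = 0 ∧
    (∀ k ≤ n, (π'.s (f k)).1.1 = (π.s k).1 ∧ (π'.s (f k)).1.2 ≠ none ∧
          (∀ c : C, (π'.s (f k)).2 (some c) = (π.s k).2 c)) ∧
    (∀ k < n, ExStep p lam π π' f k)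

/-! ### Strategies -/

/-- A strategy: given the length `n` of the history and a play (of which only
the first `n` steps are meaningful), produce a move. -/
abbrev Strategy (L C Act : Type) := ℕ → RawPlay L C Act → Mv Act

/-- A strategy depends only on the (relevant prefix of the) history. -/
def PrefixDep (σ : Strategy L C Act) : Prop :=
  ∀ n (π π' : RawPlay L C Act), (∀ k ≤ n, π.s k = π'.s k) →
    (∀ k < n, π.m1 k = π'.m1 k ∧ π.m2 k = π'.m2 k) → σ n π = σ n π'

/-- A move-independent strategy: it depends only on the sequence of states. -/
def MoveIndep (σ : Strategy L C Act) : Prop :=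
  ∀ n (π π' : RawPlay L C Act), (∀ k ≤ n, π.s k = π'.s k) → σ n π = σ n π'

/-- `σ` is a valid player-1 strategy in `G`. -/
def IsStrategy1 (G : TG L C Act) (σ : Strategy L C Act) : Prop :=
  PrefixDep σ ∧ ∀ n π, G.IsPlayUpTo π n → G.Move1 (π.s n) (σ n π)

/-- The play `π` is consistent with the player-1 strategy `σ`. -/
def Consistent1 (σ : Strategy L C Act) (π : RawPlay L C Act) : Prop :=
  ∀ n, π.m1 n = σ n π

/-- Player 1 is not responsible for the transition at step `n` of `π`. -/
def NotResp1 (G : TG L C Act) (π : RawPlay L C Act) (n : ℕ) : Prop :=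
  (π.m2 n).1 < (π.m1 n).1 ∨
  ((π.m1 n).1 = (π.m2 n).1 ∧ ¬ G.ta.Trans (π.s n) (π.m1 n) (π.s (n + 1)))

/-- A play is `P₁`-blameless if from some step on, player 1 is never
responsible for the transition. -/
def Blameless1 (G : TG L C Act) (π : RawPlay L C Act) : Prop :=
  ∃ N, ∀ n ≥ N, NotResp1 G π n

/-- `σ` is a winning player-1 strategy from `s0` for the objective `Ψ`:
every consistent play from `s0` is either time-divergent and in `Ψ`, or
time-convergent and `P₁`-blameless. -/
def Winning1 (G : TG L C Act) (σ : Strategy L C Act) (Ψ : Set (Trace L C))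
    (s0 : L × Val C) : Prop :=
  IsStrategy1 G σ ∧ ∀ π : RawPlay L C Act, G.IsPlay π → π.s 0 = s0 → Consistent1 σ π →
    (TimeDiv G.ta.gamma π.trace ∧ π.trace ∈ Ψ) ∨
    (¬ TimeDiv G.ta.gamma π.trace ∧ Blameless1 G π)

/-! ### The multi-dimensional expanded automaton -/

/-- Locations of the multi-dimensional expanded automaton. -/
abbrev MExpLoc (L : Type) (k : ℕ) := L × Option (Fin k → ℕ)
/-- Clocks of the multi-dimensional expanded automaton: `Sum.inr i` is `z_i`. -/
abbrev MExpClock (C : Type) (k : ℕ) := C ⊕ Fin k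

/-- The update function for vectors of priorities. -/
def mUp {k : ℕ} (q : Fin k → ℕ) (p : L → Fin k → ℕ) (ℓ : L) : Fin k → ℕ :=
  fun i => if q i % 2 = 1 then min (q i) (p ℓ i) else p ℓ i

/-- The multi-dimensional expanded timed automaton `A(p, λ)` for a
`k`-dimensional priority function with priorities in `{0, …, d-1}`. -/
def mExpTA (A : TA L C Act) (k d : ℕ) (hk : 0 < k) (p : L → Fin k → ℕ)
    (lam : Fin k → ℕ) : TA (MExpLoc L k) (MExpClock C k) (ExpAct Act) where
  init := (A.init, some (p A.init))
  gamma := Sum.inl A.gamma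
  inv := fun lq =>
    match lq.2 with
    | some q => liftCC Sum.inl (A.inv lq.1) ++
        ((List.finRange k).filter (fun i => decide (q i % 2 = 1))).map
          (fun i => ⟨Sum.inr i, Cmp.le, lam i⟩)
    | none => [⟨Sum.inr ⟨0, hk⟩, Cmp.le, 0⟩, ⟨Sum.inr ⟨0, hk⟩, Cmp.ge, 0⟩]
  edges :=
    {e : Edge (MExpLoc L k) (MExpClock C k) (ExpAct Act) |
      ∃ q : Fin k → ℕ, (∀ i, q i < d) ∧ ∃ e₀ ∈ A.edges,
        e = ⟨(e₀.src, some q),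
             liftCC Sum.inl e₀.guard ++
               ((List.finRange k).filter (fun i => decide (q i % 2 = 1))).map
                 (fun i => ⟨Sum.inr i, Cmp.lt, lam i⟩),
             Sum.inl e₀.act,
             (Sum.inl '' e₀.resets) ∪ (Sum.inr '' {i : Fin k | ¬ q i % 2 = 1}),
             (e₀.tgt, some (mUp q p e₀.tgt))⟩} ∪
    {e : Edge (MExpLoc L k) (MExpClock C k) (ExpAct Act) |
      ∃ q : Fin k → ℕ, (∀ i, q i < d) ∧ ∃ (ℓ : L) (i : Fin k) (b : Bool), q i % 2 = 1 ∧
        e = ⟨(ℓ, some q),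
             [⟨Sum.inr i, Cmp.le, lam i⟩, ⟨Sum.inr i, Cmp.ge, lam i⟩] ++
               ((List.finRange k).filter (fun j => decide (j < i ∧ q j % 2 = 1))).map
                 (fun j => ⟨Sum.inr j, Cmp.lt, lam j⟩),
             Sum.inr b, Sum.inr '' (Set.univ : Set (Fin k)), (ℓ, none)⟩} ∪
    {e : Edge (MExpLoc L k) (MExpClock C k) (ExpAct Act) |
      ∃ (ℓ : L) (b : Bool), e = ⟨(ℓ, none), [], Sum.inr b, ∅, (ℓ, some (p ℓ))⟩}

/-- The multi-dimensional expanded timed game `G(p, λ)`. -/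
def mExpTG (G : TG L C Act) (k d : ℕ) (hk : 0 < k) (p : L → Fin k → ℕ)
    (lam : Fin k → ℕ) : TG (MExpLoc L k) (MExpClock C k) (ExpAct Act) :=
  ⟨mExpTA G.ta k d hk p lam,
   fun a => match a with | Sum.inl a => G.isP1 a | Sum.inr b => b = true⟩

/-- The set of bad locations of the multi-dimensional expanded automaton. -/
def MBadLocs (L : Type) (k : ℕ) : Set (MExpLoc L k) := {lq | lq.2 = none}

/-- The generalized timed window objective `GTW(p, λ)`. -/
def GTW (γ : C) {k : ℕ} (p : L → Fin k → ℕ) (lam : Fin k → ℕ) : Set (Trace L C) :=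
  {τ | ∀ i : Fin k, τ ∈ TW γ (fun ℓ => p ℓ i) (lam i)}

/-- The generalized direct timed window objective `GDTW(p, λ)`. -/
def GDTW (γ : C) {k : ℕ} (p : L → Fin k → ℕ) (lam : Fin k → ℕ) : Set (Trace L C) :=
  {τ | ∀ i : Fin k, τ ∈ DTW γ (fun ℓ => p ℓ i) (lam i)}

end TWPaper
namespace TWPaper

lemma resetV_le (D : Set C) (ν : Val C) (x : C) : resetV D ν x ≤ ν x := by
  unfold resetV
  split_ifs
  · exact zero_le
  · exact le_rfl

lemma resetV_of_notMem {D : Set C} (ν : Val C) {x : C} (hx : x ∉ D) :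
    resetV D ν x = ν x := by
  simp [resetV, hx]

section ExpandedGame

variable {A : TA L C Act} {d lam : ℕ} {p : L → ℕ}
  {s s' : ExpLoc L × Val (ExpClock C)} {m : Mv (ExpAct Act)}

/-- The expansion preserves the property that `γ` is never reset. -/
lemma expTA_gamma_notMem_resets (hγ : ∀ e ∈ A.edges, A.gamma ∉ e.resets)
    {e : Edge (ExpLoc L) (ExpClock C) (ExpAct Act)} (he : e ∈ (expTA A d p lam).edges) :
    some A.gamma ∉ e.resets := by
  rcases he with ((⟨q, -, -, e₀, he₀, rfl⟩ | ⟨q, -, -, e₀, he₀, rfl⟩) | ⟨q, -, -, ℓ, b, rfl⟩) |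
    ⟨ℓ, b, rfl⟩
  · simpa using hγ e₀ he₀
  · simpa using hγ e₀ he₀
  · simp
  · simp

lemma expTA_trans_gamma (hγ : ∀ e ∈ A.edges, A.gamma ∉ e.resets)
    (h : (expTA A d p lam).Trans s m s') :
    s'.2 (some A.gamma) = s.2 (some A.gamma) + m.1 := by
  obtain ⟨t, _ | a⟩ := m
  · rw [h.2.2]
    rfl
  · obtain ⟨-, e, he, -, -, -, -, hs', -⟩ := h
    rw [hs', resetV_of_notMem _ (expTA_gamma_notMem_resets hγ he)]
    rfl

lemma TA.Trans.val_le {B : TA L C Act} {s s' : L × Val C} {m : Mv Act}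
    (h : B.Trans s m s') (x : C) : s'.2 x ≤ s.2 x + m.1 := by
  obtain ⟨t, _ | a⟩ := m
  · rw [h.2.2]
    rfl
  · obtain ⟨-, e, -, -, -, -, -, hs', -⟩ := h
    rw [hs']
    exact resetV_le _ _ _

/-- The invariant of bad locations forces `z = 0`. -/
lemma expTA_trans_z_eq_zero (h : (expTA A d p lam).Trans s m s') (hs : s.1 ∈ BadLocs L) :
    s.2 none = 0 := by
  obtain ⟨⟨ℓ, q⟩, ν⟩ := s
  obtain rfl : q = none := hs
  have hz := h.1 ⟨none, Cmp.le, 0⟩ (by simp [expTA])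
  simp only [Atom.sat, shift, Nat.cast_zero, nonpos_iff_eq_zero, add_eq_zero] at hz
  exact hz.1

/-- A bad location can only be entered when `z` reaches `λ`. -/
lemma expTA_trans_enter_bad (h : (expTA A d p lam).Trans s m s') (hs : s.1 ∉ BadLocs L)
    (hs' : s'.1 ∈ BadLocs L) : (lam : ℝ≥0) ≤ s.2 none + m.1 := by
  obtain ⟨t, _ | a⟩ := m
  · exact absurd (h.2.1 ▸ hs') hs
  · obtain ⟨-, e, he, -, -, hg, htgt, -, -⟩ := h
    rw [htgt] at hs'
    rcases he with ((⟨q, -, -, e₀, -, rfl⟩ | ⟨q, -, -, e₀, -, rfl⟩) | ⟨q, -, -, ℓ, b, rfl⟩) |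
      ⟨ℓ, b, rfl⟩
    · simp [BadLocs] at hs'
    · simp [BadLocs] at hs'
    · exact hg ⟨none, Cmp.ge, lam⟩ (by simp)
    · simp [BadLocs] at hs'

lemma TG.IsPlay.exists_trans {G : TG L C Act} {π : RawPlay L C Act} (h : G.IsPlay π) (n : ℕ) :
    ∃ m, G.ta.Trans (π.s n) m (π.s (n + 1)) := by
  rcases (h n).2.2 with ⟨-, h⟩ | ⟨-, h⟩ | ⟨-, h | h⟩ <;> exact ⟨_, h⟩

variable {G : TG L C Act} {π : RawPlay (ExpLoc L) (ExpClock C) (ExpAct Act)}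

/-- After a visit to a bad location, `z` is at most the time elapsed since that visit. -/
lemma expTG_gamma_add_z_le (hγ : ∀ e ∈ G.ta.edges, G.ta.gamma ∉ e.resets)
    (h : (expTG G d p lam).IsPlay π) {n : ℕ} (hn : (π.s n).1 ∈ BadLocs L)
    {j : ℕ} (hj : n ≤ j) :
    (π.s n).2 (some G.ta.gamma) + (π.s j).2 none ≤ (π.s j).2 (some G.ta.gamma) := by
  induction j, hj using Nat.le_induction with
  | base =>
    obtain ⟨m, hm⟩ := h.exists_trans n
    rw [expTA_trans_z_eq_zero hm hn, add_zero]
  | succ j _ ih =>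
    obtain ⟨m, hm⟩ := h.exists_trans j
    calc (π.s n).2 (some G.ta.gamma) + (π.s (j + 1)).2 none
        ≤ (π.s n).2 (some G.ta.gamma) + ((π.s j).2 none + m.1) := by
          gcongr
          exact hm.val_le none
      _ ≤ (π.s j).2 (some G.ta.gamma) + m.1 := by
          rw [← add_assoc]
          gcongr
      _ = (π.s (j + 1)).2 (some G.ta.gamma) := (expTA_trans_gamma hγ hm).symm

/-- Leaving the bad locations and entering them again takes at least `λ` time units. -/
lemma expTG_exists_bad_add_le (hγ : ∀ e ∈ G.ta.edges, G.ta.gamma ∉ e.resets)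
    (h : (expTG G d p lam).IsPlay π)
    (hbad : ∀ N, ∃ n ≥ N, (π.s n).1 ∈ BadLocs L) (hgood : ∀ N, ∃ n ≥ N, (π.s n).1 ∉ BadLocs L)
    {n : ℕ} (hn : (π.s n).1 ∈ BadLocs L) :
    ∃ k, (π.s k).1 ∈ BadLocs L ∧
      (π.s n).2 (some G.ta.gamma) + lam ≤ (π.s k).2 (some G.ta.gamma) := by
  obtain ⟨k, hnk, hk⟩ := hgood n
  obtain ⟨j, hkj, hj, hj'⟩ :
      ∃ j ≥ k, (π.s j).1 ∉ BadLocs L ∧ (π.s (j + 1)).1 ∈ BadLocs L := by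
    by_contra! hcon
    obtain ⟨b, hkb, hb⟩ := hbad k
    exact Nat.le_induction (P := fun j _ => (π.s j).1 ∉ BadLocs L) hk hcon b hkb hb
  obtain ⟨m, hm⟩ := h.exists_trans j
  refine ⟨j + 1, hj', ?_⟩
  calc (π.s n).2 (some G.ta.gamma) + lam
      ≤ (π.s n).2 (some G.ta.gamma) + ((π.s j).2 none + m.1) := by
        gcongr
        exact expTA_trans_enter_bad hm hj hj'
    _ ≤ (π.s j).2 (some G.ta.gamma) + m.1 := by
        rw [← add_assoc]
        gcongr
        exact expTG_gamma_add_z_le hγ h hn (hnk.trans hkj)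
    _ = (π.s (j + 1)).2 (some G.ta.gamma) := (expTA_trans_gamma hγ hm).symm

lemma expTG_timeDiv (hγ : ∀ e ∈ G.ta.edges, G.ta.gamma ∉ e.resets)
    (hlam : lam ≠ 0) (h : (expTG G d p lam).IsPlay π)
    (hbad : ∀ N, ∃ n ≥ N, (π.s n).1 ∈ BadLocs L)
    (hgood : ∀ N, ∃ n ≥ N, (π.s n).1 ∉ BadLocs L) :
    TimeDiv (some G.ta.gamma) π.trace := by
  have key : ∀ i : ℕ, ∃ n, (π.s n).1 ∈ BadLocs L ∧ (i : ℝ≥0) ≤ (π.s n).2 (some G.ta.gamma) := by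
    intro i
    induction i with
    | zero =>
      obtain ⟨n, -, hn⟩ := hbad 0
      exact ⟨n, hn, by simp⟩
    | succ i ih =>
      obtain ⟨n, hn, hi⟩ := ih
      obtain ⟨k, hk, hle⟩ := expTG_exists_bad_add_le hγ h hbad hgood hn
      refine ⟨k, hk, le_trans ?_ hle⟩
      push_cast
      gcongr
      exact_mod_cast Nat.one_le_iff_ne_zero.mpr hlam
  intro B
  obtain ⟨i, hi⟩ := exists_nat_gt B
  obtain ⟨n, -, hn⟩ := key i
  exact ⟨n, hi.trans_le hn⟩

end ExpandedGame

/-- Every time-convergent infinite play of the expanded game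
`G(p,λ)` visits bad locations only finitely often or visits non-bad locations
only finitely often, i.e., it belongs to `coBüchi(L'∖Bad) ∪ coBüchi(Bad)`;
moreover no infinite play belongs to both sets. -/
theorem statement10 {L C Act : Type} [Finite L] [Finite C] [Finite Act]
    (G : TG L C Act) (hwf : G.ta.WellFormed)
    (d : ℕ) (p : L → ℕ) (hp : ∀ ℓ, p ℓ < d)
    (lam : ℕ) (hlam : lam ≠ 0) :
    (∀ π' : RawPlay (ExpLoc L) (ExpClock C) (ExpAct Act),
      (expTG G d p lam).IsPlay π' → ¬ TimeDiv (some G.ta.gamma) π'.trace →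
      π'.trace ∈ CoBuchiObj (BadLocs L)ᶜ ∨ π'.trace ∈ CoBuchiObj (BadLocs L)) ∧
    (∀ π' : RawPlay (ExpLoc L) (ExpClock C) (ExpAct Act),
      (expTG G d p lam).IsPlay π' →
      ¬ (π'.trace ∈ CoBuchiObj (BadLocs L)ᶜ ∧ π'.trace ∈ CoBuchiObj (BadLocs L))) := by
  refine ⟨fun π hπ hconv => ?_, fun π _ h => ?_⟩
  · by_contra! hcon
    obtain ⟨h₁, h₂⟩ := hcon
    refine hconv (expTG_timeDiv hwf.1 hlam hπ (fun N => ?_) (fun N => ?_))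
    · by_contra! hN
      exact h₂ ⟨N, hN⟩
    · by_contra! hN
      exact h₁ ⟨N, fun n hn => not_not_intro (hN n hn)⟩
  · obtain ⟨⟨N, hN⟩, M, hM⟩ := h
    exact hN (max N M) (le_max_left _ _) (hM (max N M) (le_max_right _ _))

end TWPaper
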